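/- Let m ≥ 3 be an integer and set m₊ = m/2 if m is even and m₊ = (m+1)/2 if m is odd. Define d_n = c_{m,2n+1}/(4^n·(n!)²) for n ≥ 0. Then there exist polynomials Q_0, …, Q_{m₊} with rational coefficients, not all zero, such that for every integer n ≥ 0 both: (i) Σ_{j=0}^{m₊} Q_j(n−j)·d_{n−j} = 0, where terms with n−j < 0 are omitted, and (ii) Σ_{j=0}^{m₊} Q_j(−(n+j+1))·A_{n+j}^{(m)} = 0. (Equivalently, the series y = Σ_{n≥0} d_n x^n and w = Σ_{n≥0} A_n^{(m)} x^{−(n+1)} satisfy the same differential equation Σ_{j=0}^{m₊} x^j Q_j(θ) with θ = x·d/dx.) -/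

import Mathlib

open MeasureTheory

/-- The modified Bessel function `K₀`, via `K₀(x) = ∫₀^∞ exp(−x cosh t) dt`. -/
noncomputable def besselK0 (x : ℝ) : ℝ :=
  ∫ t in Set.Ioi (0 : ℝ), Real.exp (-x * Real.cosh t)

/-- The Bessel moment `c_{m,k} = ∫₀^∞ x^k K₀(x)^m dx`. -/
noncomputable def besselMoment (m k : ℕ) : ℝ :=
  ∫ x in Set.Ioi (0 : ℝ), x ^ k * besselK0 x ^ m

/-- `A_n^{(m)} = Σ_{i₁+⋯+i_m=n} (n!/(i₁!⋯i_m!))²` (as a real number). -/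
noncomputable def A (m n : ℕ) : ℝ :=
  ∑ f ∈ Finset.Nat.antidiagonalTuple m n,
    ((n.factorial : ℝ) / ∏ i, ((f i).factorial : ℝ)) ^ 2

open Polynomial in
/-- The coefficient polynomials of the iterated operators `L₀ = 1`, `L₁ = θ`,
`L_{k+1} = θ L_k - k (m + 1 - k) x L_{k-1}`, where `θ = x d/dx`: the entry at `(k, j)` is the
polynomial in `θ` multiplying a shift by `j`. -/
noncomputable def symPowPoly (m : ℕ) : ℕ → ℕ → ℚ[X]
  | 0, 0 => 1
  | 0, _ + 1 => 0
  | 1, 0 => X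
  | 1, _ + 1 => 0
  | k + 2, 0 => X * symPowPoly m (k + 1) 0
  | k + 2, j + 1 => X * symPowPoly m (k + 1) (j + 1)
      - C (((k : ℚ) + 1) * ((m : ℚ) - k)) * (symPowPoly m k j).comp (X - 1)

lemma symPowPoly_zero_right (m k : ℕ) : symPowPoly m k 0 = Polynomial.X ^ k := by
  induction k using Nat.twoStepInduction with
  | zero => simp [symPowPoly]
  | one => simp [symPowPoly]
  | more k _ ih => rw [symPowPoly, ih, pow_succ' _ (k + 1)]

lemma sum_symPowPoly {α : Type*} [AddCommMonoid α] (m : ℕ) (s : α) (τ : α → ℝ)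
    (hτ : ∀ a, τ (a + s) = τ a - 1) (M : ℕ → α → ℝ)
    (h_one : ∀ a, M 1 a = τ a * M 0 a)
    (h_step : ∀ k a, M (k + 2) a =
      τ a * M (k + 1) a - ((k : ℝ) + 1) * ((m : ℝ) - k) * M k (a + s))
    (k : ℕ) : ∀ (a : α) (J : ℕ), k < 2 * J →
      M k a = ∑ j ∈ Finset.range J,
        Polynomial.aeval (τ a) (symPowPoly m k j) * M 0 (a + j • s) := by
  induction k using Nat.twoStepInduction with
  | zero =>
    intro a J hJ
    obtain ⟨J, rfl⟩ : ∃ i, J = i + 1 := ⟨J - 1, by omega⟩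
    simp [Finset.sum_range_succ', symPowPoly]
  | one =>
    intro a J hJ
    obtain ⟨J, rfl⟩ : ∃ i, J = i + 1 := ⟨J - 1, by omega⟩
    simp [Finset.sum_range_succ', symPowPoly, h_one]
  | more k ih₀ ih₁ =>
    intro a J hJ
    obtain ⟨J, rfl⟩ : ∃ i, J = i + 1 := ⟨J - 1, by omega⟩
    rw [h_step, ih₁ a (J + 1) (by omega), ih₀ (a + s) J (by omega), Finset.sum_range_succ',
      Finset.sum_range_succ', mul_add, Finset.mul_sum, Finset.mul_sum, add_sub_right_comm,
      ← Finset.sum_sub_distrib]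
    congr 1
    · refine Finset.sum_congr rfl fun j _ => ?_
      have h : a + s + j • s = a + (j + 1) • s := by rw [succ_nsmul', add_assoc]
      simp only [h, symPowPoly, map_sub, map_mul, Polynomial.aeval_X,
        Polynomial.aeval_comp, hτ, map_one, map_add, map_natCast]
      ring
    · simp only [symPowPoly, map_mul, Polynomial.aeval_X]
      ring

section PowerSeriesSide

open PowerSeries

/-- The power series `∑ zⁿ / (n!)²`, that is `I₀(2√z)`. -/
noncomputable def besselISeries : ℝ⟦X⟧ := PowerSeries.mk fun n => 1 / (n.factorial : ℝ) ^ 2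

lemma coeff_besselISeries_pow (m n : ℕ) :
    coeff n (besselISeries ^ m) = A m n / (n.factorial : ℝ) ^ 2 := by
  have h : besselISeries ^ m = ∏ _i : Fin m, besselISeries := by simp
  rw [h, PowerSeries.coeff_prod, A, Finset.sum_div]
  refine Finset.sum_bij (fun l _ => ⇑l) (fun l hl => ?_) (fun l _ l' _ h => DFunLike.coe_injective h)
    (fun l hl => ⟨Finsupp.equivFunOnFinite.symm l, ?_, ?_⟩) (fun l _ => ?_)
  · simpa [Finset.Nat.mem_antidiagonalTuple] using hl
  · simpa [Finset.Nat.mem_antidiagonalTuple] using hl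
  · simp
  · have := Nat.factorial_ne_zero n
    simp only [besselISeries, coeff_mk, Finset.prod_div_distrib, Finset.prod_const_one,
      Finset.prod_pow, div_pow]
    field_simp

lemma X_mul_derivative_X_mul_derivative_besselISeries :
    X * d⁄dX ℝ (X * d⁄dX ℝ besselISeries) = X * besselISeries := by
  ext n
  rcases n with _ | n
  · simp
  · simp only [coeff_succ_X_mul, coeff_derivative, besselISeries, coeff_mk]
    rw [Nat.factorial_succ]
    have := Nat.factorial_ne_zero n
    push_cast
    field_simp

/-- The series `m (m-1) ⋯ (m-k+1) f^{m-k} (θ f)^k` with `f = I₀(2√z)`. -/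
noncomputable def besselIFamily (m k : ℕ) : ℝ⟦X⟧ :=
  (m.descFactorial k : ℝ⟦X⟧) * (besselISeries ^ (m - k) * (X * d⁄dX ℝ besselISeries) ^ k)

lemma X_mul_derivative_besselIFamily_zero (m : ℕ) :
    X * d⁄dX ℝ (besselIFamily m 0) = besselIFamily m 1 := by
  simp [besselIFamily]
  ring

lemma X_mul_derivative_besselIFamily_succ (m k : ℕ) :
    X * d⁄dX ℝ (besselIFamily m (k + 1)) = besselIFamily m (k + 2) +
      ((k : ℝ⟦X⟧) + 1) * ((m : ℝ⟦X⟧) - (k : ℝ⟦X⟧)) * (X * besselIFamily m k) := by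
  rcases lt_trichotomy k m with h | rfl | h
  · obtain ⟨r, rfl⟩ : ∃ r, m = k + 1 + r := ⟨m - (k + 1), by omega⟩
    have h1 : k + 1 + r - (k + 1) = r := by omega
    have h2 : k + 1 + r - (k + 2) = r - 1 := by omega
    have h3 : k + 1 + r - k = r + 1 := by omega
    have h4 := X_mul_derivative_X_mul_derivative_besselISeries
    simp only [besselIFamily, Nat.descFactorial_succ, h1, h2, h3]
    set f := besselISeries
    set g : ℝ⟦X⟧ := X * d⁄dX ℝ f with hg
    set c : ℝ⟦X⟧ := ((k + 1 + r).descFactorial k : ℝ⟦X⟧)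
    simp only [Derivation.leibniz, PowerSeries.derivative_pow, smul_eq_mul, Nat.cast_mul,
      Derivation.map_natCast, Nat.add_sub_cancel]
    push_cast
    linear_combination (↑r + 1) * c * f ^ r * (↑k + 1) * g ^ k * h4 -
      (↑r + 1) * c * g ^ (k + 1) * r * f ^ (r - 1) * hg
  · simp [besselIFamily]
  · simp [besselIFamily, Nat.descFactorial_of_lt, h]

/-- The coefficients of `besselIFamily`, extended by zero to negative indices. -/
noncomputable def besselICoeff (m k : ℕ) : ℤ → ℝ
  | Int.ofNat n => coeff n (besselIFamily m k)
  | Int.negSucc _ => 0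

lemma besselICoeff_one (m : ℕ) (n : ℤ) :
    besselICoeff m 1 n = (n : ℝ) * besselICoeff m 0 n := by
  rcases n with n | n
  · have h := congrArg (coeff n) (X_mul_derivative_besselIFamily_zero m)
    rcases n with _ | n
    · simpa [besselICoeff] using h.symm
    · rw [coeff_succ_X_mul, coeff_derivative] at h
      simp only [besselICoeff, ← h, Int.ofNat_eq_natCast]
      push_cast
      ring
  · simp [besselICoeff]

lemma besselICoeff_add_two (m k : ℕ) (n : ℤ) :
    besselICoeff m (k + 2) n = (n : ℝ) * besselICoeff m (k + 1) n -
      ((k : ℝ) + 1) * ((m : ℝ) - k) * besselICoeff m k (n + -1) := by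
  rcases n with n | n
  · have hc : ((k : ℝ⟦X⟧) + 1) * ((m : ℝ⟦X⟧) - (k : ℝ⟦X⟧)) = C (((k : ℝ) + 1) * ((m : ℝ) - k)) := by simp
    have h := congrArg (coeff n) (X_mul_derivative_besselIFamily_succ m k)
    rw [hc, map_add, coeff_C_mul] at h
    rcases n with _ | n
    · have h0 : Int.ofNat 0 + -1 = Int.negSucc 0 := rfl
      rw [h0]
      simp only [coeff_zero_X_mul] at h
      simp only [besselICoeff]
      simp at h ⊢
      linarith
    · have h0 : Int.ofNat (n + 1) + -1 = Int.ofNat n := by simp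
      rw [h0]
      simp only [coeff_succ_X_mul, coeff_derivative] at h
      simp only [besselICoeff, Int.ofNat_eq_natCast]
      push_cast
      linarith
  · have h0 : Int.negSucc n + -1 = Int.negSucc (n + 1) := by omega
    simp [h0, besselICoeff]

lemma sum_symPowPoly_A (m n J : ℕ) (hJ : m + 1 < 2 * J) (hn : J ≤ n + 1) :
    ∑ j ∈ Finset.range J, Polynomial.aeval (n : ℝ) (symPowPoly m (m + 1) j) *
      (A m (n - j) / ((n - j).factorial : ℝ) ^ 2) = 0 := by
  have h := sum_symPowPoly m (-1 : ℤ) (fun n => (n : ℝ)) (fun a => by push_cast; ring)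
    (besselICoeff m) (besselICoeff_one m) (besselICoeff_add_two m) (m + 1) (n : ℤ) J hJ
  have h0 : besselICoeff m (m + 1) n = 0 := by
    change coeff n (besselIFamily m (m + 1)) = 0
    simp [besselIFamily]
  rw [h0] at h
  rw [h]
  refine Finset.sum_congr rfl fun j hj => ?_
  have hj' : j ≤ n := by have := Finset.mem_range.1 hj; omega
  have h1 : (n : ℤ) + j • (-1 : ℤ) = ((n - j : ℕ) : ℤ) := by push_cast [hj']; simp; ring
  rw [h1]
  change _ = _ * coeff (n - j) (besselIFamily m 0)
  simp [besselIFamily, coeff_besselISeries_pow]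

end PowerSeriesSide

section MomentSide

open Set Filter Topology

lemma mul_cosh_pow_mul_exp_le {ε x t : ℝ} {p : ℕ} (hε : 0 < ε) (hε₁ : ε ≤ 1) (hp : p ≤ 2)
    (hx : 0 < x) :
    (x * Real.cosh t) ^ p * Real.exp (-x * Real.cosh t) ≤
      98 * (x ^ (-ε) * Real.exp (-x / 2)) * Real.exp (-ε * t) := by
  have hc := Real.one_le_cosh t
  have hc0 := Real.cosh_pos t
  set y := x * Real.cosh t with hy
  have hy0 : 0 < y := by positivity
  have h1 : y ^ p * y ^ ε ≤ 49 * Real.exp (y / 2) := by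
    have h2 : y ^ 3 ≤ 48 * Real.exp (y / 2) := by
      have := Real.pow_div_factorial_le_exp (y / 2) (by positivity) 3
      norm_num [Nat.factorial] at this
      linarith
    have h3 : 1 ≤ Real.exp (y / 2) := Real.one_le_exp (by positivity)
    rw [← Real.rpow_natCast, ← Real.rpow_add hy0]
    rcases le_total y 1 with h | h
    · have := Real.rpow_le_one hy0.le h (show 0 ≤ (p : ℝ) + ε by positivity)
      linarith
    · have hp' : (p : ℝ) ≤ 2 := by exact_mod_cast hp
      have := Real.rpow_le_rpow_of_exponent_le h (show (p : ℝ) + ε ≤ (3 : ℕ) by push_cast; linarith)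
      rw [Real.rpow_natCast] at this
      linarith
  have h4 : y ^ p * Real.exp (-y) ≤ 49 * (y ^ (-ε) * Real.exp (-y / 2)) := by
    have h5 : Real.exp (-y) = Real.exp (-y / 2) * Real.exp (-y / 2) := by
      rw [← Real.exp_add]; ring_nf
    have h6 : Real.exp (y / 2) * Real.exp (-y / 2) = 1 := by
      rw [← Real.exp_add]; ring_nf; simp
    have h7 : y ^ ε * y ^ (-ε) = 1 := by
      rw [← Real.rpow_add hy0]; simp
    have h8 : 0 < y ^ (-ε) := by positivity
    calc y ^ p * Real.exp (-y)
        = (y ^ p * y ^ ε) * (y ^ (-ε) * Real.exp (-y / 2) * Real.exp (-y / 2)) := by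
          rw [h5]; linear_combination (-y ^ p * Real.exp (-y / 2) * Real.exp (-y / 2)) * h7
      _ ≤ (49 * Real.exp (y / 2)) * (y ^ (-ε) * Real.exp (-y / 2) * Real.exp (-y / 2)) := by
          gcongr
      _ = _ := by linear_combination (49 * y ^ (-ε) * Real.exp (-y / 2)) * h6
  have h9 : Real.exp (-y / 2) ≤ Real.exp (-x / 2) := by
    apply Real.exp_le_exp.2; nlinarith
  have h10 : y ^ (-ε) ≤ x ^ (-ε) * (2 * Real.exp (-ε * t)) := by
    rw [hy, Real.mul_rpow hx.le hc0.le]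
    gcongr
    have h11 : Real.exp t / 2 ≤ Real.cosh t := by
      rw [Real.cosh_eq]; have := Real.exp_pos (-t); linarith
    calc Real.cosh t ^ (-ε) ≤ (Real.exp t / 2) ^ (-ε) :=
          Real.rpow_le_rpow_of_nonpos (by positivity) h11 (by linarith)
      _ = 2 ^ ε * Real.exp (-ε * t) := by
          rw [Real.div_rpow (Real.exp_pos t).le (by norm_num), ← Real.exp_mul,
            Real.rpow_neg (by norm_num : (0 : ℝ) ≤ 2), div_inv_eq_mul, mul_comm, mul_comm t]
      _ ≤ 2 ^ (1 : ℝ) * Real.exp (-ε * t) := by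
          gcongr; norm_num
      _ = 2 * Real.exp (-ε * t) := by simp
  rw [show -x * Real.cosh t = -y by rw [hy]; ring]
  calc y ^ p * Real.exp (-y) ≤ 49 * (y ^ (-ε) * Real.exp (-y / 2)) := h4
    _ ≤ 49 * (x ^ (-ε) * (2 * Real.exp (-ε * t)) * Real.exp (-x / 2)) := by gcongr
    _ = _ := by ring

/-- The integrals `∫₀^∞ cosh(t)^p exp(-x cosh t) dt`. -/
noncomputable def coshIntegral (p : ℕ) (x : ℝ) : ℝ :=
  ∫ t in Ioi (0 : ℝ), Real.cosh t ^ p * Real.exp (-x * Real.cosh t)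

lemma besselK0_eq_coshIntegral : besselK0 = coshIntegral 0 := by
  ext x; simp [besselK0, coshIntegral]

lemma integrableOn_cosh_pow_mul_exp {p : ℕ} (hp : p ≤ 2) {x : ℝ} (hx : 0 < x) :
    IntegrableOn (fun t => Real.cosh t ^ p * Real.exp (-x * Real.cosh t)) (Ioi 0) := by
  have hi : IntegrableOn (fun t => (98 * (x ^ (-1 : ℝ) * Real.exp (-x / 2)) / x ^ p) *
      Real.exp (-1 * t)) (Ioi 0) := (exp_neg_integrableOn_Ioi 0 one_pos).const_mul _
  refine Integrable.mono' hi (by fun_prop) (ae_of_all _ fun t => ?_)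
  have h := mul_cosh_pow_mul_exp_le (t := t) one_pos le_rfl hp hx
  have := Real.cosh_pos t
  rw [Real.norm_of_nonneg (by positivity), div_mul_eq_mul_div, le_div_iff₀ (by positivity)]
  rw [mul_pow] at h
  linarith

lemma pow_mul_coshIntegral_le {ε x : ℝ} {p : ℕ} (hε : 0 < ε) (hε₁ : ε ≤ 1) (hp : p ≤ 2)
    (hx : 0 < x) :
    x ^ p * coshIntegral p x ≤ 98 / ε * (x ^ (-ε) * Real.exp (-x / 2)) := by
  have hi := (exp_neg_integrableOn_Ioi 0 hε).const_mul (98 * (x ^ (-ε) * Real.exp (-x / 2)))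
  have h := integral_mono ((integrableOn_cosh_pow_mul_exp hp hx).const_mul (x ^ p)) hi
    (fun t => by
      have := mul_cosh_pow_mul_exp_le (t := t) hε hε₁ hp hx
      rw [mul_pow, mul_assoc] at this
      exact this)
  rw [integral_const_mul, integral_const_mul,
    integral_exp_mul_Ioi (by linarith : -ε < 0)] at h
  refine h.trans_eq ?_
  simp
  field_simp

lemma coshIntegral_nonneg (p : ℕ) (x : ℝ) : 0 ≤ coshIntegral p x :=
  integral_nonneg fun t => by have := Real.cosh_pos t; positivity

lemma hasDerivAt_coshIntegral {p : ℕ} (hp : p ≤ 1) {x : ℝ} (hx : 0 < x) :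
    HasDerivAt (coshIntegral p) (-coshIntegral (p + 1) x) x := by
  have h := (hasDerivAt_integral_of_dominated_loc_of_deriv_le
    (μ := volume.restrict (Ioi (0 : ℝ))) (s := Ioi (x / 2))
    (F := fun x t => Real.cosh t ^ p * Real.exp (-x * Real.cosh t))
    (F' := fun x t => -(Real.cosh t ^ (p + 1) * Real.exp (-x * Real.cosh t)))
    (bound := fun t => Real.cosh t ^ (p + 1) * Real.exp (-(x / 2) * Real.cosh t))
    (Ioi_mem_nhds (by linarith)) (Eventually.of_forall fun x => by fun_prop)
    (integrableOn_cosh_pow_mul_exp (by omega) hx) (by fun_prop)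
    (ae_of_all _ fun t y hy => ?_)
    (integrableOn_cosh_pow_mul_exp (by omega) (by linarith))
    (ae_of_all _ fun t y hy => ?_)).2
  · rwa [integral_neg] at h
  · have := Real.cosh_pos t
    have hy' : x / 2 < y := hy
    rw [norm_neg, Real.norm_of_nonneg (by positivity)]
    gcongr
  · have h1 : HasDerivAt (fun y : ℝ => -y * Real.cosh t) (-Real.cosh t) y := by
      simpa using (hasDerivAt_id y).neg.mul_const (Real.cosh t)
    exact (h1.exp.const_mul (Real.cosh t ^ p)).congr_deriv (by ring)

lemma coshIntegral_one_eq {x : ℝ} (hx : 0 < x) :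
    coshIntegral 1 x = x * (coshIntegral 2 x - coshIntegral 0 x) := by
  have hd : ∀ t ∈ Ici (0 : ℝ), HasDerivAt (fun t => Real.sinh t * Real.exp (-x * Real.cosh t))
      (Real.cosh t ^ 1 * Real.exp (-x * Real.cosh t) -
        x * (Real.cosh t ^ 2 * Real.exp (-x * Real.cosh t) -
          Real.cosh t ^ 0 * Real.exp (-x * Real.cosh t))) t := fun t _ => by
    refine ((Real.hasDerivAt_sinh t).mul
      ((Real.hasDerivAt_cosh t).const_mul (-x)).exp).congr_deriv ?_
    have := Real.cosh_sq t
    linear_combination (x * Real.exp (-x * Real.cosh t)) * this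
  have h0 := integrableOn_cosh_pow_mul_exp (p := 0) (by norm_num) hx
  have h1 := integrableOn_cosh_pow_mul_exp (p := 1) (by norm_num) hx
  have h2 := integrableOn_cosh_pow_mul_exp (p := 2) (by norm_num) hx
  have ht : Tendsto (fun t => Real.sinh t * Real.exp (-x * Real.cosh t)) atTop (𝓝 0) := by
    have hz : Tendsto (fun t => 98 * (x ^ (-1 : ℝ) * Real.exp (-x / 2)) / x * Real.exp (-1 * t))
        atTop (𝓝 0) := by
      have : Tendsto (fun t : ℝ => Real.exp (-1 * t)) atTop (𝓝 0) := by
        simpa using Real.tendsto_exp_neg_atTop_nhds_zero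
      simpa using this.const_mul (98 * (x ^ (-1 : ℝ) * Real.exp (-x / 2)) / x)
    refine squeeze_zero_norm (fun t => ?_) hz
    have h := mul_cosh_pow_mul_exp_le (t := t) (p := 1) one_pos le_rfl (by norm_num) hx
    have hs : |Real.sinh t| ≤ Real.cosh t := by
      rw [← Real.cosh_abs, Real.abs_sinh]; exact (Real.sinh_lt_cosh _).le
    rw [norm_mul, Real.norm_eq_abs, Real.norm_of_nonneg (Real.exp_pos _).le, div_mul_eq_mul_div,
      le_div_iff₀ hx]
    refine le_trans ?_ h
    rw [pow_one]
    calc _ ≤ Real.cosh t * Real.exp (-x * Real.cosh t) * x := by gcongr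
      _ = _ := by ring
  have h20 : IntegrableOn (fun t => x * (Real.cosh t ^ 2 * Real.exp (-x * Real.cosh t) -
      Real.cosh t ^ 0 * Real.exp (-x * Real.cosh t))) (Ioi 0) := (h2.sub h0).const_mul x
  have h := integral_Ioi_of_hasDerivAt_of_tendsto' hd (h1.sub h20) ht
  rw [integral_sub h1 h20, integral_const_mul, integral_sub h2 h0] at h
  simp only [Real.sinh_zero, zero_mul, sub_zero] at h
  exact sub_eq_zero.1 h

/-- `θ K₀`, where `θ = x d/dx`. -/
noncomputable def thetaBesselK0 (x : ℝ) : ℝ := -(x * coshIntegral 1 x)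

lemma hasDerivAt_besselK0 {x : ℝ} (hx : 0 < x) :
    HasDerivAt besselK0 (thetaBesselK0 x / x) x := by
  rw [besselK0_eq_coshIntegral]
  refine (hasDerivAt_coshIntegral (by norm_num) hx).congr_deriv ?_
  rw [thetaBesselK0]
  field_simp

lemma hasDerivAt_thetaBesselK0 {x : ℝ} (hx : 0 < x) :
    HasDerivAt thetaBesselK0 (x * besselK0 x) x := by
  refine ((hasDerivAt_id x).mul (hasDerivAt_coshIntegral le_rfl hx)).neg.congr_deriv ?_
  have := coshIntegral_one_eq hx
  simp only [id, besselK0_eq_coshIntegral]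
  linarith

/-- The function `m (m-1) ⋯ (m-k+1) K₀^{m-k} (θ K₀)^k`. -/
noncomputable def besselKFamily (m k : ℕ) (x : ℝ) : ℝ :=
  (m.descFactorial k : ℝ) * (besselK0 x ^ (m - k) * thetaBesselK0 x ^ k)

lemma hasDerivAt_besselKFamily_zero (m : ℕ) {x : ℝ} (hx : 0 < x) :
    HasDerivAt (besselKFamily m 0) (besselKFamily m 1 x / x) x := by
  have h : besselKFamily m 0 = fun x => besselK0 x ^ m := by ext; simp [besselKFamily]
  rw [h]
  refine ((hasDerivAt_besselK0 hx).pow m).congr_deriv ?_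
  simp [besselKFamily]
  ring

lemma hasDerivAt_besselKFamily_succ (m k : ℕ) {x : ℝ} (hx : 0 < x) :
    HasDerivAt (besselKFamily m (k + 1)) ((besselKFamily m (k + 2) x +
      ((k : ℝ) + 1) * ((m : ℝ) - k) * (x ^ 2 * besselKFamily m k x)) / x) x := by
  refine ((((hasDerivAt_besselK0 hx).pow (m - (k + 1))).mul
    ((hasDerivAt_thetaBesselK0 hx).pow (k + 1))).const_mul
      (m.descFactorial (k + 1) : ℝ)).congr_deriv ?_
  rcases lt_trichotomy k m with h | rfl | h
  · obtain ⟨r, rfl⟩ : ∃ r, m = k + 1 + r := ⟨m - (k + 1), by omega⟩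
    have h1 : k + 1 + r - (k + 1) = r := by omega
    have h2 : k + 1 + r - (k + 2) = r - 1 := by omega
    have h3 : k + 1 + r - k = r + 1 := by omega
    simp only [besselKFamily, Nat.descFactorial_succ, h1, h2, h3, Nat.add_sub_cancel]
    push_cast
    simp only [Pi.pow_apply]
    field_simp
    ring
  · simp [besselKFamily]
  · simp [besselKFamily, Nat.descFactorial_of_lt, h]

lemma exists_abs_besselKFamily_le {m : ℕ} (hm : 0 < m) (k : ℕ) :
    ∃ C, 0 ≤ C ∧ ∀ x, 0 < x → |besselKFamily m k x| ≤ C * (x⁻¹ * Real.exp (-x / 2)) := by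
  rcases lt_or_ge m k with hk | hk
  · exact ⟨0, le_rfl, fun x _ => by simp [besselKFamily, Nat.descFactorial_of_lt hk]⟩
  have hε : (0 : ℝ) < (m : ℝ)⁻¹ := by positivity
  have hε₁ : (m : ℝ)⁻¹ ≤ 1 := inv_le_one_of_one_le₀ (by exact_mod_cast hm)
  refine ⟨m.descFactorial k * (98 / (m : ℝ)⁻¹) ^ m, by positivity, fun x hx => ?_⟩
  have h0 := pow_mul_coshIntegral_le (p := 0) hε hε₁ (by norm_num) hx
  have h1 := pow_mul_coshIntegral_le (p := 1) hε hε₁ (by norm_num) hx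
  rw [pow_zero, one_mul, ← besselK0_eq_coshIntegral] at h0
  set B := 98 / (m : ℝ)⁻¹ * (x ^ (-(m : ℝ)⁻¹) * Real.exp (-x / 2)) with hB
  have hB0 : 0 ≤ B := by positivity
  have hK : |besselK0 x| ≤ B := by
    rwa [abs_of_nonneg (by rw [besselK0_eq_coshIntegral]; exact coshIntegral_nonneg 0 x)]
  have hT : |thetaBesselK0 x| ≤ B := by
    rw [pow_one] at h1
    rwa [thetaBesselK0, abs_neg, abs_of_nonneg (mul_nonneg hx.le (coshIntegral_nonneg 1 x))]
  have hx1 : (x ^ (-(m : ℝ)⁻¹)) ^ m = x⁻¹ := by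
    rw [← Real.rpow_natCast, ← Real.rpow_mul hx.le, neg_mul, inv_mul_cancel₀ (by positivity),
      Real.rpow_neg_one]
  have he : Real.exp (-x / 2) ^ m ≤ Real.exp (-x / 2) :=
    pow_le_of_le_one (Real.exp_pos _).le (Real.exp_le_one_iff.2 (by linarith)) hm.ne'
  calc |besselKFamily m k x|
      = m.descFactorial k * (|besselK0 x| ^ (m - k) * |thetaBesselK0 x| ^ k) := by
        rw [besselKFamily, abs_mul, abs_mul, abs_pow, abs_pow, Nat.abs_cast]
    _ ≤ m.descFactorial k * (B ^ (m - k) * B ^ k) := by gcongr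
    _ = m.descFactorial k * (98 / (m : ℝ)⁻¹) ^ m * (x⁻¹ * Real.exp (-x / 2) ^ m) := by
        rw [← pow_add, Nat.sub_add_cancel hk, hB, mul_pow, mul_pow, hx1]; ring
    _ ≤ _ := by gcongr

lemma continuousOn_besselKFamily (m k : ℕ) : ContinuousOn (besselKFamily m k) (Ioi 0) := by
  intro x hx
  exact (((hasDerivAt_besselK0 hx).continuousAt.pow (m - k)).mul
    ((hasDerivAt_thetaBesselK0 hx).continuousAt.pow k)).const_mul _ |>.continuousWithinAt

lemma integrableOn_pow_succ_mul_besselKFamily {m : ℕ} (hm : 0 < m) (k n : ℕ) :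
    IntegrableOn (fun x => x ^ (n + 1) * besselKFamily m k x) (Ioi 0) := by
  obtain ⟨C, hC, h⟩ := exists_abs_besselKFamily_le hm k
  have hi : IntegrableOn (fun x : ℝ => C * (x ^ (n : ℝ) * Real.exp (-(1 / 2) * x))) (Ioi 0) :=
    (integrableOn_rpow_mul_exp_neg_mul_rpow (p := 1) (b := 1 / 2) (s := n)
      (by have : (0 : ℝ) ≤ n := by positivity
          linarith) one_pos (by norm_num)
      |>.congr_fun (fun x _ => by simp) measurableSet_Ioi).const_mul C
  refine Integrable.mono' hi (((continuousOn_id.pow _).mul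
    (continuousOn_besselKFamily m k)).aestronglyMeasurable measurableSet_Ioi) ?_
  refine (ae_restrict_iff' measurableSet_Ioi).2 (ae_of_all _ fun x hx => ?_)
  have hx' : 0 < x := hx
  rw [norm_mul, norm_pow, Real.norm_eq_abs, Real.norm_eq_abs, abs_of_pos hx', Real.rpow_natCast]
  calc x ^ (n + 1) * |besselKFamily m k x|
      ≤ x ^ (n + 1) * (C * (x⁻¹ * Real.exp (-x / 2))) := by gcongr; exact h x hx'
    _ = C * (x ^ n * Real.exp (-(1 / 2) * x)) := by
        rw [show -(1 / 2) * x = -x / 2 by ring]; field_simp; ring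

lemma abs_pow_mul_besselKFamily_le {m : ℕ} (hm : 0 < m) (k n : ℕ) :
    ∃ C, ∀ x, 0 < x → ‖x ^ (n + 2) * besselKFamily m k x‖ ≤
      C * (x ^ (n + 1) * Real.exp (-(1 / 2) * x)) := by
  obtain ⟨C, hC, h⟩ := exists_abs_besselKFamily_le hm k
  refine ⟨C, fun x hx => ?_⟩
  rw [norm_mul, norm_pow, Real.norm_eq_abs, Real.norm_eq_abs, abs_of_pos hx]
  calc x ^ (n + 2) * |besselKFamily m k x|
      ≤ x ^ (n + 2) * (C * (x⁻¹ * Real.exp (-x / 2))) := by gcongr; exact h x hx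
    _ = C * (x ^ (n + 1) * Real.exp (-(1 / 2) * x)) := by
        rw [show -(1 / 2) * x = -x / 2 by ring]; field_simp; ring

lemma tendsto_pow_mul_besselKFamily_zero {m : ℕ} (hm : 0 < m) (k n : ℕ) :
    Tendsto (fun x => x ^ (n + 2) * besselKFamily m k x) (𝓝[>] 0) (𝓝 0) := by
  obtain ⟨C, h⟩ := abs_pow_mul_besselKFamily_le hm k n
  have ht : Tendsto (fun x : ℝ => C * (x ^ (n + 1) * Real.exp (-(1 / 2) * x))) (𝓝[>] 0) (𝓝 0) := by
    have : Continuous (fun x : ℝ => C * (x ^ (n + 1) * Real.exp (-(1 / 2) * x))) := by fun_prop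
    simpa using (this.tendsto 0).mono_left nhdsWithin_le_nhds
  exact squeeze_zero_norm' (eventually_mem_nhdsWithin.mono h) ht

lemma tendsto_pow_mul_besselKFamily_atTop {m : ℕ} (hm : 0 < m) (k n : ℕ) :
    Tendsto (fun x => x ^ (n + 2) * besselKFamily m k x) atTop (𝓝 0) := by
  obtain ⟨C, h⟩ := abs_pow_mul_besselKFamily_le hm k n
  have ht : Tendsto (fun x : ℝ => C * (x ^ (n + 1) * Real.exp (-(1 / 2) * x))) atTop (𝓝 0) := by
    have := (tendsto_rpow_mul_exp_neg_mul_atTop_nhds_zero (n + 1 : ℕ) (1 / 2)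
      (by norm_num)).const_mul C
    simpa only [Real.rpow_natCast, mul_zero] using this
  exact squeeze_zero_norm' ((eventually_gt_atTop 0).mono h) ht

/-- The integrals `∫₀^∞ x^{2n+1} F_k(x) dx` of `F_k = besselKFamily m k`, normalized. -/
noncomputable def besselKMoment (m k n : ℕ) : ℝ :=
  (∫ x in Ioi (0 : ℝ), x ^ (2 * n + 1) * besselKFamily m k x) / (2 ^ k * 4 ^ n)

lemma integral_pow_mul_of_hasDerivAt {m : ℕ} (hm : 0 < m) (k n : ℕ) {F : ℝ → ℝ}
    (hF : ∀ x, 0 < x → HasDerivAt (besselKFamily m k) (F x / x) x)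
    (hi : IntegrableOn (fun x => x ^ (2 * n + 1) * F x) (Ioi 0)) :
    ∫ x in Ioi (0 : ℝ), x ^ (2 * n + 1) * F x =
      -(2 * (n + 1)) * ∫ x in Ioi (0 : ℝ), x ^ (2 * n + 1) * besselKFamily m k x := by
  have hc : EqOn (fun x => x ^ (2 * n + 1) * F x) (fun x => x ^ (2 * n + 2) * (F x / x))
      (Ioi 0) := fun x hx => by
    have : x ≠ 0 := (mem_Ioi.1 hx).ne'
    simp only
    field_simp
    ring
  have hu : IntegrableOn ((fun x => ((2 * n + 2 : ℕ) : ℝ) * x ^ (2 * n + 1)) * besselKFamily m k)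
      (Ioi 0) := by
    have := (integrableOn_pow_succ_mul_besselKFamily hm k (2 * n)).const_mul ((2 * n + 2 : ℕ) : ℝ)
    simp only [← mul_assoc] at this
    exact this
  have h := integral_Ioi_mul_deriv_eq_deriv_mul (a := (0 : ℝ)) (u := fun x => x ^ (2 * n + 2))
    (u' := fun x => ((2 * n + 2 : ℕ) : ℝ) * x ^ (2 * n + 1)) (v := besselKFamily m k)
    (v' := fun x => F x / x) (fun x _ => hasDerivAt_pow (2 * n + 2) x) hF
    (hi.congr_fun hc measurableSet_Ioi)
    hu
    (tendsto_pow_mul_besselKFamily_zero hm k (2 * n))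
    (tendsto_pow_mul_besselKFamily_atTop hm k (2 * n))
  rw [setIntegral_congr_fun measurableSet_Ioi hc, h]
  simp only [mul_assoc, integral_const_mul]
  push_cast
  ring

lemma besselKMoment_one {m : ℕ} (hm : 0 < m) (n : ℕ) :
    besselKMoment m 1 n = -((n : ℝ) + 1) * besselKMoment m 0 n := by
  rw [besselKMoment, besselKMoment, integral_pow_mul_of_hasDerivAt hm 0 n
    (fun x hx => hasDerivAt_besselKFamily_zero m hx)
    (integrableOn_pow_succ_mul_besselKFamily hm 1 (2 * n))]
  field_simp

lemma besselKMoment_add_two {m : ℕ} (hm : 0 < m) (k n : ℕ) :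
    besselKMoment m (k + 2) n = -((n : ℝ) + 1) * besselKMoment m (k + 1) n -
      ((k : ℝ) + 1) * ((m : ℝ) - k) * besselKMoment m k (n + 1) := by
  have h1 := integrableOn_pow_succ_mul_besselKFamily hm (k + 2) (2 * n)
  have h2 := (integrableOn_pow_succ_mul_besselKFamily hm k (2 * (n + 1))).const_mul
    (((k : ℝ) + 1) * ((m : ℝ) - k))
  have he : (fun x => x ^ (2 * n + 1) * (besselKFamily m (k + 2) x +
      ((k : ℝ) + 1) * ((m : ℝ) - k) * (x ^ 2 * besselKFamily m k x))) =
      fun x => x ^ (2 * n + 1) * besselKFamily m (k + 2) x +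
        ((k : ℝ) + 1) * ((m : ℝ) - k) * (x ^ (2 * (n + 1) + 1) * besselKFamily m k x) := by
    ext x; ring
  have h := integral_pow_mul_of_hasDerivAt hm (k + 1) n
    (fun x hx => hasDerivAt_besselKFamily_succ m k hx) (by rw [he]; exact h1.add h2)
  rw [he, integral_add h1 h2, integral_const_mul] at h
  simp only [besselKMoment, pow_succ] at h ⊢
  field_simp
  linear_combination 4 * h

lemma sum_symPowPoly_besselMoment {m : ℕ} (hm : 0 < m) (n J : ℕ) (hJ : m + 1 < 2 * J) :
    ∑ j ∈ Finset.range J, Polynomial.aeval (-((n : ℝ) + 1)) (symPowPoly m (m + 1) j) *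
      (besselMoment m (2 * (n + j) + 1) / 4 ^ (n + j)) = 0 := by
  have h := sum_symPowPoly m (1 : ℕ) (fun n => -((n : ℝ) + 1)) (fun a => by push_cast; ring)
    (besselKMoment m) (besselKMoment_one hm) (besselKMoment_add_two hm) (m + 1) n J hJ
  have h0 : besselKMoment m (m + 1) n = 0 := by simp [besselKMoment, besselKFamily]
  rw [h0] at h
  rw [h]
  simp [besselKMoment, besselKFamily, besselMoment]

end MomentSide

open Polynomial in
/-- The common recurrence polynomials, in the reflected index `J = m₊ - j`. -/
noncomputable def recurrencePoly (m J : ℕ) : ℚ[X] :=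
  (symPowPoly m (m + 1) J).comp (C ((J : ℚ) - 1) - X) * descPochhammer ℚ J ^ 2

lemma aeval_recurrencePoly (m J : ℕ) (x : ℝ) :
    Polynomial.aeval x (recurrencePoly m J) =
      Polynomial.aeval ((J : ℝ) - 1 - x) (symPowPoly m (m + 1) J) *
        (descPochhammer ℝ J).eval x ^ 2 := by
  have h : Polynomial.aeval x (descPochhammer ℚ J) = (descPochhammer ℝ J).eval x := by
    rw [← descPochhammer_map (algebraMap ℚ ℝ) J, Polynomial.eval_map_algebraMap]
  simp [recurrencePoly, Polynomial.aeval_comp, h]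

lemma recurrencePoly_zero_ne_zero (m : ℕ) : recurrencePoly m 0 ≠ 0 := by
  intro h
  have := congrArg (Polynomial.eval 0) h
  simp [recurrencePoly, symPowPoly_zero_right] at this

lemma sum_recurrencePoly_moment {m p : ℕ} (hm : 0 < m) (hp : m + 1 < 2 * (p + 1)) (n : ℕ) :
    ∑ j ∈ Finset.range (p + 1),
      (if j ≤ n then Polynomial.aeval ((n : ℝ) - j) (recurrencePoly m (p - j)) *
        (besselMoment m (2 * (n - j) + 1) / (4 ^ (n - j) * ((n - j).factorial : ℝ) ^ 2))
      else 0) = 0 := by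
  rcases lt_or_ge n p with hn | hn
  · refine Finset.sum_eq_zero fun j hj => ?_
    split_ifs with hjn
    · rw [aeval_recurrencePoly, ← Nat.cast_sub hjn, descPochhammer_eval_eq_descFactorial,
        Nat.descFactorial_of_lt (by omega)]
      simp
    · rfl
  · obtain ⟨N, rfl⟩ : ∃ N, n = N + p := ⟨n - p, by omega⟩
    have h := congrArg (((N.factorial : ℝ) ^ 2)⁻¹ * ·)
      (sum_symPowPoly_besselMoment hm N (p + 1) hp)
    simp only [mul_zero] at h
    rw [← h, Finset.mul_sum, ← Finset.sum_range_reflect]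
    refine Finset.sum_congr rfl fun J hJ => ?_
    have hJ' : J ≤ p := by have := Finset.mem_range.1 hJ; omega
    obtain ⟨q, rfl⟩ : ∃ q, p = J + q := ⟨p - J, by omega⟩
    have h1 : J + q + 1 - 1 - J = q := by omega
    have h2 : J + q - q = J := by omega
    have h3 : N + (J + q) - q = N + J := by omega
    have h4 := Nat.factorial_mul_descFactorial (Nat.le_add_left J N)
    rw [Nat.add_sub_cancel] at h4
    have h5 : ((N + (J + q) : ℕ) : ℝ) - q = (N + J : ℕ) := by push_cast; ring
    have h6 : (J : ℝ) - 1 - (N + J : ℕ) = -((N : ℝ) + 1) := by push_cast; ring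
    have := Nat.factorial_ne_zero N
    have : (N + J).descFactorial J ≠ 0 := by simp [Nat.descFactorial_eq_zero_iff_lt]
    rw [h1, h2, h3, if_pos (by omega), h5, aeval_recurrencePoly,
      descPochhammer_eval_eq_descFactorial, h6, ← h4]
    push_cast
    field_simp

lemma descPochhammer_eval_neg_sq_mul_factorial_sq (k J : ℕ) :
    (descPochhammer ℝ J).eval (-((k : ℝ) + 1)) ^ 2 * (k.factorial : ℝ) ^ 2 =
      ((k + J).factorial : ℝ) ^ 2 := by
  induction J with
  | zero => simp
  | succ J ih =>
    rw [descPochhammer_succ_eval, ← add_assoc, Nat.factorial_succ]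
    push_cast
    linear_combination ((k : ℝ) + J + 1) ^ 2 * ih

lemma sum_recurrencePoly_A {m p : ℕ} (hp : m + 1 < 2 * (p + 1)) (n : ℕ) :
    ∑ j ∈ Finset.range (p + 1),
      Polynomial.aeval (-((n : ℝ) + j + 1)) (recurrencePoly m (p - j)) * A m (n + j) = 0 := by
  have h := congrArg (((n + p).factorial : ℝ) ^ 2 * ·)
    (sum_symPowPoly_A m (n + p) (p + 1) hp (by omega))
  simp only [mul_zero] at h
  rw [← h, Finset.mul_sum, ← Finset.sum_range_reflect]
  refine Finset.sum_congr rfl fun J hJ => ?_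
  have hJ' : J ≤ p := by have := Finset.mem_range.1 hJ; omega
  obtain ⟨q, rfl⟩ : ∃ q, p = J + q := ⟨p - J, by omega⟩
  have h1 : J + q + 1 - 1 - J = q := by omega
  have h2 : J + q - q = J := by omega
  have h3 : n + (J + q) - J = n + q := by omega
  have h4 : (descPochhammer ℝ J).eval (-((n : ℝ) + q + 1)) ^ 2 * ((n + q).factorial : ℝ) ^ 2 =
      ((n + (J + q)).factorial : ℝ) ^ 2 := by
    have := descPochhammer_eval_neg_sq_mul_factorial_sq (n + q) J
    rwa [add_assoc, add_comm q J, Nat.cast_add] at this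
  rw [h1, h2, h3, aeval_recurrencePoly, ← h4]
  have h5 : (J : ℝ) - 1 - -((n : ℝ) + q + 1) = (n + (J + q) : ℕ) := by push_cast; ring
  have := Nat.factorial_ne_zero (n + q)
  rw [h5]
  field_simp

/-- **Main Theorem.** For `m ≥ 3`, with `m₊ = m/2` for even `m` and `(m+1)/2` for odd `m`,
and `d_n = c_{m,2n+1}/(4ⁿ (n!)²)`, there are rational polynomials `Q_0, …, Q_{m₊}`,
not all zero, such that for every `n ≥ 0`:
(i) `Σ_{j=0}^{m₊} Q_j(n−j) d_{n−j} = 0` (terms with `n−j < 0` omitted), and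
(ii) `Σ_{j=0}^{m₊} Q_j(−(n+j+1)) A_{n+j}^{(m)} = 0`. -/
theorem main_theorem (m : ℕ) (hm : 3 ≤ m)
    (d : ℕ → ℝ)
    (hd : ∀ n, d n = besselMoment m (2 * n + 1) / (4 ^ n * (n.factorial : ℝ) ^ 2)) :
    ∃ Q : ℕ → Polynomial ℚ,
      (∃ j, j ≤ (if m % 2 = 0 then m / 2 else (m + 1) / 2) ∧ Q j ≠ 0) ∧
      (∀ n : ℕ, ∑ j ∈ Finset.range ((if m % 2 = 0 then m / 2 else (m + 1) / 2) + 1),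
          (if j ≤ n then Polynomial.aeval ((n : ℝ) - j) (Q j) * d (n - j) else 0) = 0) ∧
      (∀ n : ℕ, ∑ j ∈ Finset.range ((if m % 2 = 0 then m / 2 else (m + 1) / 2) + 1),
          Polynomial.aeval (-((n : ℝ) + j + 1)) (Q j) * A m (n + j) = 0) := by
  have hp : (if m % 2 = 0 then m / 2 else (m + 1) / 2) = (m + 1) / 2 := by
    split_ifs <;> omega
  rw [hp]
  refine ⟨fun j => recurrencePoly m ((m + 1) / 2 - j), ⟨(m + 1) / 2, le_rfl, ?_⟩,
    fun n => ?_, sum_recurrencePoly_A (by omega)⟩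
  · simpa using recurrencePoly_zero_ne_zero m
  · simp only [hd]
    exact sum_recurrencePoly_moment (by omega) (by omega) n
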